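/- Let ν be a measure on ℝ^d with ν({0}) = 0, and let ν' be its dual defined by ν'(B) = ∫ 1_B(ι(x)) |x|² ν(dx) with ι(x) = x/|x|². Then ∫ (|x|² ∧ 1) ν'(dx) = ∫ (|x|² ∧ 1) ν(dx). -/

import Mathlib

open MeasureTheory Set ENNReal

/-- The dual measure preserves the integral of `|x|² ∧ 1`. -/
theorem stmt_3 {d : ℕ} (ν ν' : Measure (EuclideanSpace ℝ (Fin d)))
    (hν0 : ν {0} = 0)
    (hdual : ∀ B : Set (EuclideanSpace ℝ (Fin d)), MeasurableSet B →
      ν' B = ∫⁻ x in ({0}ᶜ : Set (EuclideanSpace ℝ (Fin d))),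
        B.indicator (fun _ => (1 : ℝ≥0∞)) ((‖x‖ ^ 2)⁻¹ • x) * (‖x‖₊ : ℝ≥0∞) ^ 2 ∂ν) :
    ∫⁻ x, min ((‖x‖₊ : ℝ≥0∞) ^ 2) 1 ∂ν' = ∫⁻ x, min ((‖x‖₊ : ℝ≥0∞) ^ 2) 1 ∂ν := by
  have hι : Measurable (fun x : EuclideanSpace ℝ (Fin d) => (‖x‖ ^ 2)⁻¹ • x) := by fun_prop
  have hw : Measurable (fun x : EuclideanSpace ℝ (Fin d) => (‖x‖₊ : ℝ≥0∞) ^ 2) := by fun_prop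
  have hm : Measurable (fun x : EuclideanSpace ℝ (Fin d) => min ((‖x‖₊ : ℝ≥0∞) ^ 2) 1) := by
    fun_prop
  have hν' : ν' = ((ν.restrict {0}ᶜ).withDensity
      (fun x => (‖x‖₊ : ℝ≥0∞) ^ 2)).map (fun x => (‖x‖ ^ 2)⁻¹ • x) := by
    ext B hB
    rw [hdual B hB, Measure.map_apply hι hB, withDensity_apply _ (hι hB),
      ← lintegral_indicator (hι hB)]
    refine lintegral_congr fun x => ?_
    by_cases hx : (‖x‖ ^ 2)⁻¹ • x ∈ B
    · rw [indicator_of_mem hx, indicator_of_mem (by exact hx), one_mul]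
    · rw [indicator_of_notMem hx, indicator_of_notMem (by exact hx), zero_mul]
  have hae : ({0}ᶜ : Set (EuclideanSpace ℝ (Fin d))) =ᵐ[ν] univ := by
    rw [ae_eq_univ, compl_compl]; exact hν0
  rw [hν', lintegral_map hm hι]
  refine (lintegral_withDensity_eq_lintegral_mul _ hw (hm.comp hι)).trans ?_
  have h2 : ∫⁻ x, min ((‖x‖₊ : ℝ≥0∞) ^ 2) 1 ∂ν
      = ∫⁻ x in ({0}ᶜ : Set (EuclideanSpace ℝ (Fin d))), min ((‖x‖₊ : ℝ≥0∞) ^ 2) 1 ∂ν := by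
    rw [Measure.restrict_congr_set hae, Measure.restrict_univ]
  rw [h2]
  refine setLIntegral_congr_fun (measurableSet_singleton 0).compl fun x hx => ?_
  have hx0 : ‖x‖₊ ≠ 0 := by simpa using hx
  have key : ‖x‖₊ ^ 2 * min (‖(‖x‖ ^ 2)⁻¹ • x‖₊ ^ 2) 1 = min (‖x‖₊ ^ 2) 1 := by
    rw [mul_min, mul_one, min_comm]
    congr 1
    rw [nnnorm_smul, nnnorm_inv, nnnorm_pow, nnnorm_norm]
    field_simp
  simp only [Pi.mul_apply, Function.comp_apply]
  exact_mod_cast key
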